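/- Fix an intuitionistic agenda Φ and an odd number n ≥ 3 of agents. Φ satisfies the median property if and only if for every profile (J_1,…,J_n) of IL-consistent judgment sets over Φ (not necessarily complete), the majority outcome M(J) is IL-consistent. -/

import Mathlib

namespace Stmt5

inductive IForm : Type
  | atom : ℕ → IForm
  | bot  : IForm
  | conj : IForm → IForm → IForm
  | disj : IForm → IForm → IForm
  | imp  : IForm → IForm → IForm
  deriving DecidableEq

def IForm.not (φ : IForm) : IForm := φ.imp .bot

/-- Intuitionistic derivability Γ ⊢ φ (natural deduction, equivalent to Gentzen's LJ). -/
inductive ILDeriv : Set IForm → IForm → Prop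
  | ax {Γ : Set IForm} {φ} : φ ∈ Γ → ILDeriv Γ φ
  | andI {Γ φ ψ} : ILDeriv Γ φ → ILDeriv Γ ψ → ILDeriv Γ (IForm.conj φ ψ)
  | andE1 {Γ φ ψ} : ILDeriv Γ (IForm.conj φ ψ) → ILDeriv Γ φ
  | andE2 {Γ φ ψ} : ILDeriv Γ (IForm.conj φ ψ) → ILDeriv Γ ψ
  | orI1 {Γ φ ψ} : ILDeriv Γ φ → ILDeriv Γ (IForm.disj φ ψ)
  | orI2 {Γ φ ψ} : ILDeriv Γ ψ → ILDeriv Γ (IForm.disj φ ψ)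
  | orE {Γ φ ψ χ} : ILDeriv Γ (IForm.disj φ ψ) → ILDeriv (insert φ Γ) χ →
      ILDeriv (insert ψ Γ) χ → ILDeriv Γ χ
  | impI {Γ φ ψ} : ILDeriv (insert φ Γ) ψ → ILDeriv Γ (IForm.imp φ ψ)
  | impE {Γ φ ψ} : ILDeriv Γ (IForm.imp φ ψ) → ILDeriv Γ φ → ILDeriv Γ ψ
  | botE {Γ φ} : ILDeriv Γ .bot → ILDeriv Γ φ

def ILConsistent (S : Finset IForm) : Prop := ¬ ILDeriv (↑S : Set IForm) .bot

/-- The complement ∼φ : ψ if φ = ¬ψ (= ψ → ⊥), and ¬φ otherwise. -/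
def IForm.compl : IForm → IForm
  | .imp ψ .bot => ψ
  | φ           => φ.not

def isTautology (φ : IForm) : Prop := ILDeriv (∅ : Set IForm) φ
def isContradiction (φ : IForm) : Prop := ILDeriv ({φ} : Set IForm) .bot

def isAgenda (Φ : Finset IForm) : Prop :=
  (∀ φ ∈ Φ, φ.compl ∈ Φ) ∧ ∀ φ ∈ Φ, ¬ isTautology φ ∧ ¬ isContradiction φ

def nsupp (n : ℕ) (J : Fin n → Finset IForm) (φ : IForm) : ℕ :=
  (Finset.univ.filter (fun i => φ ∈ J i)).card

def maj (n : ℕ) (Φ : Finset IForm) (J : Fin n → Finset IForm) : Finset IForm :=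
  Φ.filter (fun φ => n < 2 * nsupp n J φ)

def minimallyInconsistent (Y : Finset IForm) : Prop :=
  ¬ ILConsistent Y ∧ ∀ Z ⊂ Y, ILConsistent Z

def medianProperty (Φ : Finset IForm) : Prop :=
  ∀ Y ⊆ Φ, minimallyInconsistent Y → Y.card ≤ 2

theorem ILDeriv.weaken {Γ : Set IForm} {φ : IForm} (h : ILDeriv Γ φ) :
    ∀ {Δ : Set IForm}, Γ ⊆ Δ → ILDeriv Δ φ := by
  induction h with
  | ax h => intro Δ hs; exact .ax (hs h)
  | andI _ _ ih1 ih2 => intro Δ hs; exact .andI (ih1 hs) (ih2 hs)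
  | andE1 _ ih => intro Δ hs; exact .andE1 (ih hs)
  | andE2 _ ih => intro Δ hs; exact .andE2 (ih hs)
  | orI1 _ ih => intro Δ hs; exact .orI1 (ih hs)
  | orI2 _ ih => intro Δ hs; exact .orI2 (ih hs)
  | orE _ _ _ ih1 ih2 ih3 =>
    intro Δ hs
    exact .orE (ih1 hs) (ih2 (Set.insert_subset_insert hs)) (ih3 (Set.insert_subset_insert hs))
  | impI _ ih => intro Δ hs; exact .impI (ih (Set.insert_subset_insert hs))
  | impE _ _ ih1 ih2 => intro Δ hs; exact .impE (ih1 hs) (ih2 hs)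
  | botE _ ih => intro Δ hs; exact .botE (ih hs)

theorem ILConsistent.mono {S T : Finset IForm} (h : ILConsistent T) (hs : S ⊆ T) :
    ILConsistent S := fun hd => h (hd.weaken (Finset.coe_subset.2 hs))

theorem exists_minInc (S : Finset IForm) (h : ¬ ILConsistent S) :
    ∃ Y ⊆ S, minimallyInconsistent Y := by
  induction S using Finset.strongInduction with
  | H S ih =>
    by_cases hm : ∀ Z ⊂ S, ILConsistent Z
    · exact ⟨S, Finset.Subset.refl _, h, hm⟩
    · push Not at hm
      obtain ⟨Z, hZ, hc⟩ := hm
      obtain ⟨Y, hY, hmin⟩ := ih Z hZ hc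
      exact ⟨Y, hY.trans hZ.1, hmin⟩

theorem common_agent (n : ℕ) (Φ : Finset IForm) (J : Fin n → Finset IForm) (a b : IForm)
    (ha : a ∈ maj n Φ J) (hb : b ∈ maj n Φ J) : ∃ i, a ∈ J i ∧ b ∈ J i := by
  by_contra hcon
  push Not at hcon
  have ha' := (Finset.mem_filter.1 ha).2
  have hb' := (Finset.mem_filter.1 hb).2
  unfold nsupp at ha' hb'
  have hd : Disjoint (Finset.univ.filter (fun i => a ∈ J i))
      (Finset.univ.filter (fun i => b ∈ J i)) := by
    rw [Finset.disjoint_left]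
    intro i h1 h2
    exact hcon i (Finset.mem_filter.1 h1).2 (Finset.mem_filter.1 h2).2
  have h1 := Finset.card_union_of_disjoint hd
  have h2 := Finset.card_le_univ (Finset.univ.filter (fun i => a ∈ J i) ∪
      Finset.univ.filter (fun i => b ∈ J i))
  rw [Fintype.card_fin] at h2
  omega

/-- Element dropped by agent `i` (the first `k`, the next `k`, and the remaining agents). -/
def dropped (k : ℕ) (a b c : IForm) (i : ℕ) : IForm :=
  if i < k then a else if i < 2 * k then b else c

theorem dropped_card (k : ℕ) (hk : 1 ≤ k) (a b c : IForm) (hab : a ≠ b) (hac : a ≠ c)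
    (hbc : b ≠ c) (y : IForm) :
    (Finset.univ.filter (fun i : Fin (2 * k + 1) => dropped k a b c i = y)).card ≤ k := by
  have := Finset.card_le_card_of_injOn
    (s := Finset.univ.filter (fun i : Fin (2 * k + 1) => dropped k a b c i = y))
    (t := Finset.range k)
    (fun i => if i.val < k then i.val else if i.val < 2 * k then i.val - k else 0)
    (by
      intro i _
      simp only [Finset.coe_range, Set.mem_Iio]
      split_ifs <;> omega)
    (by
      intro i hi j hj hij
      have hi' := (Finset.mem_filter.1 (Finset.mem_coe.1 hi)).2
      have hj' := (Finset.mem_filter.1 (Finset.mem_coe.1 hj)).2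
      have h := hi'.trans hj'.symm
      unfold dropped at h
      have := i.2
      have := j.2
      apply Fin.ext
      dsimp only at hij
      split_ifs at h hij <;> first | omega | exact absurd h (by first | assumption | (apply Ne.symm; assumption)))
  simpa using this

/-- an intuitionistic agenda Φ satisfies the median property iff for every
profile of IL-consistent judgment sets over Φ (not necessarily complete; n odd, n ≥ 3),
the majority outcome is IL-consistent. -/
theorem median_property_iff_majority_consistent
    (n : ℕ) (hodd : Odd n) (h3 : 3 ≤ n)
    (Φ : Finset IForm) (hΦ : isAgenda Φ) :
    medianProperty Φ ↔
      ∀ J : Fin n → Finset IForm, (∀ i, J i ⊆ Φ ∧ ILConsistent (J i)) →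
        ILConsistent (maj n Φ J) := by
  constructor
  · intro hmed J hJ hbad
    obtain ⟨Y, hY, hmin⟩ := exists_minInc (maj n Φ J) (fun h => h hbad)
    have hcard := hmed Y (hY.trans (Finset.filter_subset _ _)) hmin
    have key : ∃ i, Y ⊆ J i := by
      rcases Y.eq_empty_or_nonempty with rfl | ⟨a, ha⟩
      · exact ⟨⟨0, by omega⟩, Finset.empty_subset _⟩
      · have h1 : (Y.erase a).card ≤ 1 := by rw [Finset.card_erase_of_mem ha]; omega
        have : ∃ b ∈ Y, ∀ y ∈ Y, y = a ∨ y = b := by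
          rcases (Y.erase a).eq_empty_or_nonempty with he | ⟨b, hb⟩
          · refine ⟨a, ha, fun y hy => Or.inl ?_⟩
            by_contra hne
            have : y ∈ Y.erase a := Finset.mem_erase.2 ⟨hne, hy⟩
            simp [he] at this
          · refine ⟨b, Finset.mem_of_mem_erase hb, fun y hy => ?_⟩
            by_cases hne : y = a
            · exact Or.inl hne
            · exact Or.inr (Finset.card_le_one.1 h1 y (Finset.mem_erase.2 ⟨hne, hy⟩) b hb)
        obtain ⟨b, hb, hall⟩ := this
        obtain ⟨i, hia, hib⟩ := common_agent n Φ J a b (hY ha) (hY hb)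
        refine ⟨i, fun y hy => ?_⟩
        rcases hall y hy with rfl | rfl <;> assumption
    obtain ⟨i, hi⟩ := key
    exact hmin.1 ((hJ i).2.mono hi)
  · intro hmaj Y hY hmin
    by_contra hcard
    obtain ⟨a, b, c, ha, hb, hc, hab, hac, hbc⟩ := Finset.two_lt_card_iff.1 (not_le.1 hcard)
    obtain ⟨k, rfl⟩ := hodd
    have hmem : ∀ i, dropped k a b c i ∈ Y := by
      intro i; unfold dropped; split_ifs <;> assumption
    have hcons := hmaj (fun i => Y.erase (dropped k a b c i)) (fun i =>
      ⟨(Finset.erase_subset _ _).trans hY, hmin.2 _ (Finset.erase_ssubset (hmem i))⟩)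
    refine hmin.1 (hcons.mono fun y hy => Finset.mem_filter.2 ⟨hY hy, ?_⟩)
    have h1 := dropped_card k (by omega) a b c hab hac hbc y
    have h2 := Finset.card_filter_add_card_filter_not (s := Finset.univ)
      (fun i : Fin (2 * k + 1) => dropped k a b c i = y)
    have h3 : nsupp (2 * k + 1) (fun i => Y.erase (dropped k a b c i)) y =
        (Finset.univ.filter (fun i : Fin (2 * k + 1) => ¬ dropped k a b c i = y)).card := by
      unfold nsupp
      congr 1
      ext i
      simp [hy, eq_comm]
    rw [Finset.card_univ, Fintype.card_fin] at h2
    omega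

end Stmt5
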